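/- arXiv:2501.06569 — 6 statements merged into one kernel-verified Lean document; each statement's English description precedes it below -/
import Mathlib

section
/- If M is a perfect matching of a finite simple graph G with at least one edge, then the palette index of G is at most the palette index of G − M, where G − M is the spanning subgraph of G obtained by deleting the edges of M. -/
open SimpleGraph

/-- A proper edge coloring of `G` (colors in `ℕ`): distinct edges sharing a
vertex receive different colors. -/
def IsProperEdgeColoring {V : Type*} (G : SimpleGraph V) (f : Sym2 V → ℕ) : Prop :=
  ∀ e₁ ∈ G.edgeSet, ∀ e₂ ∈ G.edgeSet, e₁ ≠ e₂ → (∃ v, v ∈ e₁ ∧ v ∈ e₂) → f e₁ ≠ f e₂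

/-- The palette of a vertex `v` under an edge coloring `f`: the set of colors
assigned to the edges incident to `v`. -/
def palette {V : Type*} (G : SimpleGraph V) (f : Sym2 V → ℕ) (v : V) : Set ℕ :=
  {c | ∃ e ∈ G.edgeSet, v ∈ e ∧ f e = c}

/-- The number of distinct palettes of vertices of `G` with respect to `f`. -/
noncomputable def numPalettes {V : Type*} (G : SimpleGraph V) (f : Sym2 V → ℕ) : ℕ :=
  (Set.range (palette G f)).ncard

/-- The palette index `š(G)`: the minimum number of distinct vertex palettes
over all proper edge colorings of `G`. -/
noncomputable def paletteIndex {V : Type*} (G : SimpleGraph V) : ℕ :=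
  sInf {n | ∃ f, IsProperEdgeColoring G f ∧ numPalettes G f = n}

/-- The chromatic index `χ'(G)`: the minimum `n` such that `G` has a proper
edge coloring with colors from `{0, …, n-1}`. -/
noncomputable def chromIndex {V : Type*} (G : SimpleGraph V) : ℕ :=
  sInf {n | ∃ f, IsProperEdgeColoring G f ∧ ∀ e ∈ G.edgeSet, f e < n}

/-- The degree of a vertex. -/
noncomputable def vertDegree {V : Type*} (G : SimpleGraph V) (v : V) : ℕ :=
  (G.neighborSet v).ncard

/-- The maximum degree `Δ(G)`. -/
noncomputable def maxDeg {V : Type*} (G : SimpleGraph V) : ℕ :=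
  sSup (Set.range (vertDegree G))

/-- `G` is class 1 if `χ'(G) = Δ(G)`. -/
def IsClass1 {V : Type*} (G : SimpleGraph V) : Prop := chromIndex G = maxDeg G

/-- `G` is `r`-regular. -/
def IsRegularDeg {V : Type*} (G : SimpleGraph V) (r : ℕ) : Prop :=
  ∀ v, vertDegree G v = r

/-- A perfect matching: a set `M` of edges of `G` such that every vertex is
incident to exactly one edge of `M`. -/
def IsPerfectMatchingSet {V : Type*} (G : SimpleGraph V) (M : Set (Sym2 V)) : Prop :=
  M ⊆ G.edgeSet ∧ ∀ v : V, ∃! e, e ∈ M ∧ v ∈ e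

/-- If `M` is a perfect matching of a finite simple graph `G` with at
least one edge, then `š(G) ≤ š(G − M)`. -/
theorem paletteIndex_le_of_perfectMatching {V : Type*} [Fintype V] (G : SimpleGraph V)
    (M : Set (Sym2 V)) (hG : G.edgeSet.Nonempty) (hM : IsPerfectMatchingSet G M) :
    paletteIndex G ≤ paletteIndex (G.deleteEdges M) := by
  classical
  have hne : {n | ∃ f, IsProperEdgeColoring (G.deleteEdges M) f ∧
      numPalettes (G.deleteEdges M) f = n}.Nonempty := by
    haveI : Finite (Sym2 V) := inferInstance
    obtain ⟨f, hf⟩ := exists_injective_nat (Sym2 V)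
    exact ⟨_, f, fun e₁ _ e₂ _ hne _ h => hne (hf h), rfl⟩
  obtain ⟨f, hf, hn⟩ := Nat.sInf_mem hne
  have hn' : numPalettes (G.deleteEdges M) f = paletteIndex (G.deleteEdges M) := hn
  rw [← hn']
  obtain ⟨hsub, hM⟩ := hM
  set g : Sym2 V → ℕ := fun e => if e ∈ M then 0 else f e + 1 with hg
  have hgp : IsProperEdgeColoring G g := by
    intro e₁ h₁ e₂ h₂ hne hv
    by_cases m₁ : e₁ ∈ M <;> by_cases m₂ : e₂ ∈ M
    · obtain ⟨v, hv₁, hv₂⟩ := hv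
      exact absurd ((hM v).unique ⟨m₁, hv₁⟩ ⟨m₂, hv₂⟩) hne
    · simp [hg, m₁, m₂]
    · simp [hg, m₁, m₂]
    · have := hf e₁ (by rw [edgeSet_deleteEdges]; exact ⟨h₁, m₁⟩) e₂
        (by rw [edgeSet_deleteEdges]; exact ⟨h₂, m₂⟩) hne hv
      simpa [hg, m₁, m₂] using this
  have hpal : ∀ v, palette G g v =
      insert 0 (Nat.succ '' palette (G.deleteEdges M) f v) := by
    intro v
    ext c
    constructor
    · rintro ⟨e, he, hve, rfl⟩
      by_cases m : e ∈ M
      · left; simp [hg, m]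
      · right
        exact ⟨f e, ⟨e, by rw [edgeSet_deleteEdges]; exact ⟨he, m⟩, hve, rfl⟩, by simp [hg, m]⟩
    · rintro (rfl | ⟨_, ⟨e, he, hve, rfl⟩, rfl⟩)
      · obtain ⟨e, ⟨m, hve⟩, _⟩ := hM v
        exact ⟨e, hsub m, hve, by simp [hg, m]⟩
      · rw [edgeSet_deleteEdges] at he
        exact ⟨e, he.1, hve, by simp [hg, he.2]⟩
  calc paletteIndex G ≤ numPalettes G g := Nat.sInf_le ⟨g, hgp, rfl⟩
    _ ≤ numPalettes (G.deleteEdges M) f := by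
      have : Set.range (palette G g) = (fun s : Set ℕ => insert 0 (Nat.succ '' s)) ''
          Set.range (palette (G.deleteEdges M) f) := by
        rw [← Set.range_comp]
        congr 1
        funext v
        exact hpal v
      unfold numPalettes
      rw [this]
      exact Set.ncard_image_le (Set.finite_range _)
end

section
/- If G is a finite regular simple graph with at least one edge, then the palette index of G is not equal to 2. -/
open SimpleGraph

lemma exists_recolor (P Q : Finset ℕ) (h : Q.card = P.card) :
    ∃ ψ : ℕ → ℕ, (∀ c ∈ P, ψ c = c) ∧ Set.InjOn ψ (Q : Set ℕ) ∧ ψ '' (Q : Set ℕ) = (P : Set ℕ) := by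
  classical
  obtain ⟨g, hg⟩ := Finset.exists_equiv_extend_of_card_eq (α := Q) (t := P) (by simpa using h)
    (s := Finset.univ.filter (fun x : Q => (x : ℕ) ∈ P)) (f := fun x => (x : ℕ))
    (by
      intro c hc
      simp only [Finset.mem_image, Finset.mem_filter] at hc
      obtain ⟨x, hx, rfl⟩ := hc
      exact hx.2)
    (fun x _ y _ hxy => Subtype.ext hxy)
  have hval : ∀ (c : ℕ) (hc : c ∈ Q), (if h : c ∈ Q then ((g ⟨c, h⟩ : P) : ℕ) else c) = g ⟨c, hc⟩ :=
    fun c hc => dif_pos hc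
  refine ⟨fun c => if h : c ∈ Q then ((g ⟨c, h⟩ : P) : ℕ) else c, ?_, ?_, ?_⟩
  · intro c hc
    by_cases hQ : c ∈ Q
    · have := hg ⟨c, hQ⟩ (by simpa using hc)
      simpa [hQ] using this
    · simp [hQ]
  · intro a ha b hb hab
    have ha' : a ∈ Q := ha
    have hb' : b ∈ Q := hb
    simp only [hval a ha', hval b hb'] at hab
    have := g.injective (Subtype.ext hab)
    simpa using this
  · ext c
    constructor
    · rintro ⟨a, ha, rfl⟩
      have ha' : a ∈ Q := ha
      simp only [hval a ha']
      exact (g ⟨a, ha'⟩).2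
    · intro hc
      have hc' : c ∈ P := hc
      refine ⟨(g.symm ⟨c, hc'⟩ : Q), (g.symm ⟨c, hc'⟩).2, ?_⟩
      simp

lemma palette_eq_image {V : Type*} (G : SimpleGraph V) (f : Sym2 V → ℕ) (v : V) :
    palette G f v = (fun w => f s(v, w)) '' G.neighborSet v := by
  ext c
  constructor
  · rintro ⟨e, he, hv, rfl⟩
    obtain ⟨w, rfl⟩ := Sym2.mem_iff_exists.1 hv
    exact ⟨w, by simpa using he, rfl⟩
  · rintro ⟨w, hw, rfl⟩
    exact ⟨s(v, w), by simpa using hw, by simp, rfl⟩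

lemma palette_ncard {V : Type*} (G : SimpleGraph V) (f : Sym2 V → ℕ)
    (hf : IsProperEdgeColoring G f) (v : V) :
    (palette G f v).ncard = vertDegree G v := by
  rw [palette_eq_image]
  refine Set.ncard_image_of_injOn ?_
  intro a ha b hb hab
  by_contra hne
  refine hf s(v, a) (by simpa using ha) s(v, b) (by simpa using hb) ?_ ⟨v, by simp, by simp⟩ hab
  intro h
  exact hne (Sym2.congr_right.1 h)

theorem paletteIndex_ne_two_of_regular {V : Type*} [Fintype V] (G : SimpleGraph V)
    (hreg : ∃ r, IsRegularDeg G r) (hG : G.edgeSet.Nonempty) :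
    paletteIndex G ≠ 2 := by
  intro h2
  obtain ⟨r, hr⟩ := hreg
  obtain ⟨f, hf, hn⟩ : 2 ∈ {n | ∃ f, IsProperEdgeColoring G f ∧ numPalettes G f = n} := by
    have hne : {n | ∃ f, IsProperEdgeColoring G f ∧ numPalettes G f = n}.Nonempty :=
      Nat.nonempty_of_sInf_eq_succ (k := 1) h2
    have := Nat.sInf_mem hne
    unfold paletteIndex at h2
    rwa [h2] at this
  obtain ⟨P, Q, hPQ, hrange⟩ := Set.ncard_eq_two.1 hn
  obtain ⟨p, hp⟩ : P ∈ Set.range (palette G f) := by rw [hrange]; simp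
  obtain ⟨q, hq⟩ : Q ∈ Set.range (palette G f) := by rw [hrange]; simp
  have hfin : ∀ v, (palette G f v).Finite := fun v => by
    rw [palette_eq_image]; exact (Set.toFinite _).image _
  have hPf : P.Finite := hp ▸ hfin p
  have hQf : Q.Finite := hq ▸ hfin q
  have hcard : Q.ncard = P.ncard := by
    rw [← hp, ← hq, palette_ncard G f hf, palette_ncard G f hf, hr, hr]
  obtain ⟨ψ, h1, hinj, himg⟩ := exists_recolor hPf.toFinset hQf.toFinset (by
    rw [← Set.ncard_eq_toFinset_card _ hPf, ← Set.ncard_eq_toFinset_card _ hQf]; exact hcard)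
  simp only [Set.Finite.mem_toFinset, Set.Finite.coe_toFinset] at h1 hinj himg
  have hcase : ∀ v, palette G f v = P ∨ palette G f v = Q := fun v => by
    have : palette G f v ∈ Set.range (palette G f) := ⟨v, rfl⟩
    rw [hrange] at this
    simpa using this
  have hinjv : ∀ v, Set.InjOn ψ (palette G f v) := by
    intro v
    rcases hcase v with h | h <;> rw [h]
    · intro a ha b hb hab
      rwa [h1 a ha, h1 b hb] at hab
    · exact hinj
  have hpal : ∀ v, palette G (ψ ∘ f) v = P := by
    intro v
    have : palette G (ψ ∘ f) v = ψ '' palette G f v := by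
      rw [palette_eq_image, palette_eq_image, Set.image_image]; rfl
    rw [this]
    rcases hcase v with h | h <;> rw [h]
    · rw [Set.image_congr (g := id) h1, Set.image_id]
    · exact himg
  have hle : paletteIndex G ≤ 1 := by
    refine Nat.sInf_le ⟨ψ ∘ f, ?_, ?_⟩
    · rintro e₁ he₁ e₂ he₂ hne ⟨v, hv₁, hv₂⟩ heq
      exact hf e₁ he₁ e₂ he₂ hne ⟨v, hv₁, hv₂⟩
        (hinjv v ⟨e₁, he₁, hv₁, rfl⟩ ⟨e₂, he₂, hv₂, rfl⟩ heq)
    · have : Set.range (palette G (ψ ∘ f)) = {P} := by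
        ext X
        constructor
        · rintro ⟨v, rfl⟩
          exact hpal v
        · rintro rfl
          exact ⟨p, hpal p⟩
      unfold numPalettes
      rw [this, Set.ncard_singleton]
  omega
end

section
/- For all finite nonempty simple graphs G and H, the palette index of the Cartesian product G □ H is at most the product of the palette index of G and the palette index of H. -/
open SimpleGraph

lemma exists_min_coloring {V : Type*} [Finite V] (G : SimpleGraph V) :
    ∃ f, IsProperEdgeColoring G f ∧ numPalettes G f = paletteIndex G := by
  have hne : {n | ∃ f, IsProperEdgeColoring G f ∧ numPalettes G f = n}.Nonempty := by
    obtain ⟨f, hf⟩ := Countable.exists_injective_nat (Sym2 V)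
    exact ⟨_, f, fun e₁ _ e₂ _ hne _ h => hne (hf h), rfl⟩
  exact Nat.sInf_mem hne

lemma mem_palette {V : Type*} (G : SimpleGraph V) (f : Sym2 V → ℕ) (v : V) (c : ℕ) :
    c ∈ palette G f v ↔ ∃ u, G.Adj v u ∧ f s(v, u) = c := by
  constructor
  · rintro ⟨e, he, hv, rfl⟩
    obtain ⟨u, rfl⟩ := Sym2.mem_iff_exists.1 hv
    exact ⟨u, he, rfl⟩
  · rintro ⟨u, hu, rfl⟩
    exact ⟨s(v, u), hu, by simp, rfl⟩

lemma proper_iff {V : Type*} (G : SimpleGraph V) (f : Sym2 V → ℕ) :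
    IsProperEdgeColoring G f ↔
      ∀ v a b, G.Adj v a → G.Adj v b → f s(v, a) = f s(v, b) → a = b := by
  constructor
  · intro h v a b ha hb hab
    by_contra hne
    exact h s(v, a) ha s(v, b) hb (fun h => hne (Sym2.congr_right.1 h))
      ⟨v, by simp, by simp⟩ hab
  · rintro h e₁ h₁ e₂ h₂ hne ⟨v, hv₁, hv₂⟩ heq
    obtain ⟨a, rfl⟩ := Sym2.mem_iff_exists.1 hv₁
    obtain ⟨b, rfl⟩ := Sym2.mem_iff_exists.1 hv₂
    exact hne (by rw [h v a b h₁ h₂ heq])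

open Classical in
/-- The coloring of the product: even colors on `G`-edges, odd colors on `H`-edges. -/
noncomputable def prodColoring {V W : Type*} (f : Sym2 V → ℕ) (g : Sym2 W → ℕ)
    (e : Sym2 (V × W)) : ℕ :=
  if (e.map Prod.snd).IsDiag then 2 * f (e.map Prod.fst) else 2 * g (e.map Prod.snd) + 1

lemma prodColoring_left {V W : Type*} (f : Sym2 V → ℕ) (g : Sym2 W → ℕ) (v u : V) (w : W) :
    prodColoring f g s((v, w), (u, w)) = 2 * f s(v, u) := by
  simp [prodColoring]

lemma prodColoring_right {V W : Type*} (f : Sym2 V → ℕ) (g : Sym2 W → ℕ) (v u : V) (w x : W)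
    (h : w ≠ x) : prodColoring f g s((v, w), (u, x)) = 2 * g s(w, x) + 1 := by
  simp [prodColoring, h]

/-- `š(G □ H) ≤ š(G) · š(H)` for finite nonempty simple graphs. -/
theorem paletteIndex_boxProd_le {V W : Type*} [Fintype V] [Fintype W]
    [Nonempty V] [Nonempty W] (G : SimpleGraph V) (H : SimpleGraph W) :
    paletteIndex (G □ H) ≤ paletteIndex G * paletteIndex H := by
  obtain ⟨f, hf, hfn⟩ := exists_min_coloring G
  obtain ⟨g, hg, hgn⟩ := exists_min_coloring H
  rw [proper_iff] at hf hg
  have hF : IsProperEdgeColoring (G □ H) (prodColoring f g) := by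
    rw [proper_iff]
    rintro ⟨v, w⟩ ⟨a, x⟩ ⟨b, y⟩ h₁ h₂ heq
    rw [boxProd_adj] at h₁ h₂
    dsimp only at h₁ h₂
    rcases h₁ with ⟨h₁, rfl⟩ | ⟨h₁, rfl⟩ <;> rcases h₂ with ⟨h₂, rfl⟩ | ⟨h₂, rfl⟩
    · rw [prodColoring_left, prodColoring_left] at heq
      rw [hf v a b h₁ h₂ (by omega)]
    · rw [prodColoring_left, prodColoring_right _ _ _ _ _ _ h₂.ne] at heq
      omega
    · rw [prodColoring_left, prodColoring_right _ _ _ _ _ _ h₁.ne] at heq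
      omega
    · rw [prodColoring_right _ _ _ _ _ _ h₂.ne, prodColoring_right _ _ _ _ _ _ h₁.ne] at heq
      rw [hg w x y h₁ h₂ (by omega)]
  have hle : paletteIndex (G □ H) ≤ numPalettes (G □ H) (prodColoring f g) :=
    Nat.sInf_le ⟨_, hF, rfl⟩
  refine hle.trans ?_
  rw [← hfn, ← hgn]
  unfold numPalettes
  let φ : Set ℕ × Set ℕ → Set ℕ :=
    fun p => (fun c => 2 * c) '' p.1 ∪ (fun c => 2 * c + 1) '' p.2
  have hsub : Set.range (palette (G □ H) (prodColoring f g)) ⊆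
      φ '' (Set.range (palette G f) ×ˢ Set.range (palette H g)) := by
    rintro _ ⟨⟨v, w⟩, rfl⟩
    refine ⟨(palette G f v, palette H g w), ⟨⟨v, rfl⟩, ⟨w, rfl⟩⟩, ?_⟩
    ext c
    simp only [φ, Set.mem_union, Set.mem_image, mem_palette]
    constructor
    · rintro (⟨_, ⟨u, hu, rfl⟩, rfl⟩ | ⟨_, ⟨u, hu, rfl⟩, rfl⟩)
      · exact ⟨(u, w), boxProd_adj.2 (Or.inl ⟨hu, rfl⟩), prodColoring_left ..⟩
      · exact ⟨(v, u), boxProd_adj.2 (Or.inr ⟨hu, rfl⟩), prodColoring_right _ _ _ _ _ _ hu.ne⟩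
    · rintro ⟨⟨a, x⟩, h, rfl⟩
      rw [boxProd_adj] at h
      dsimp only at h
      rcases h with ⟨h, rfl⟩ | ⟨h, rfl⟩
      · exact Or.inl ⟨_, ⟨a, h, rfl⟩, (prodColoring_left ..).symm⟩
      · exact Or.inr ⟨_, ⟨x, h, rfl⟩, (prodColoring_right _ _ _ _ _ _ h.ne).symm⟩
  have hfin : (Set.range (palette G f) ×ˢ Set.range (palette H g)).Finite :=
    (Set.finite_range _).prod (Set.finite_range _)
  calc _ ≤ _ := Set.ncard_le_ncard hsub (hfin.image φ)
    _ ≤ _ := Set.ncard_image_le hfin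
    _ = _ := Set.ncard_prod
end

section
/- Let G and H be finite connected regular simple graphs such that G is class 1 and r-regular with r ≥ 2, and let e be an edge of G. Then the palette index of the Cartesian product (G − e) □ H equals 2, where G − e is the spanning subgraph of G obtained by deleting the edge e. -/
open SimpleGraph

/-- Vertexwise form of properness. -/
def PropC {V : Type*} (G : SimpleGraph V) (c : Sym2 V → ℕ) : Prop :=
  ∀ a b b', G.Adj a b → G.Adj a b' → c s(a,b) = c s(a,b') → b = b'

lemma propC_iff {V : Type*} (G : SimpleGraph V) (c : Sym2 V → ℕ) :
    IsProperEdgeColoring G c ↔ PropC G c := by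
  constructor
  · intro h a b b' h1 h2 h3
    by_contra hne
    exact h s(a,b) h1 s(a,b') h2 (fun h => hne (Sym2.congr_right.1 h)) ⟨a, by simp, by simp⟩ h3
  · rintro h e₁ h1 e₂ h2 hne ⟨v, hv1, hv2⟩ heq
    obtain ⟨b, rfl⟩ := hv1
    obtain ⟨b', rfl⟩ := hv2
    exact hne (by rw [h v b b' h1 h2 heq])

lemma mem_pal {V : Type*} (G : SimpleGraph V) (c : Sym2 V → ℕ) (v : V) (t : ℕ) :
    t ∈ palette G c v ↔ ∃ w, G.Adj v w ∧ c s(v,w) = t := by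
  constructor
  · rintro ⟨e, he, ⟨b, rfl⟩, rfl⟩
    exact ⟨b, he, rfl⟩
  · rintro ⟨w, h, rfl⟩
    exact ⟨s(v,w), h, by simp, rfl⟩

lemma pal_ncard {V : Type*} (G : SimpleGraph V) (c : Sym2 V → ℕ) (h : PropC G c) (v : V) :
    (palette G c v).ncard = vertDegree G v := by
  have : palette G c v = (fun w => c s(v,w)) '' G.neighborSet v := by
    ext t; rw [mem_pal]; simp
  rw [this, vertDegree, Set.InjOn.ncard_image]
  intro a ha b hb hab
  exact h v a b ha hb hab

open Classical in
/-- In a graph of maximum degree two, a component has at most two vertices of degree at most one. -/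
lemma comp_ends {V : Type*} [Fintype V] (K : SimpleGraph V) (h2 : ∀ v, K.degree v ≤ 2)
    (C : K.ConnectedComponent) (X : Finset V) (hX : ∀ v ∈ X, v ∈ C.supp ∧ K.degree v ≤ 1) :
    X.card ≤ 2 := by
  have hc : (K.induce C.supp).Connected := C.connected_toSimpleGraph
  have h1 := hc.card_vert_le_card_edgeSet_add_one
  have hs := (K.induce C.supp).sum_degrees_eq_twice_card_edges
  have hd : ∀ v : C.supp, (K.induce C.supp).degree v + (if v.1 ∈ X then 1 else 0) ≤ 2 := by
    intro v
    have : (K.induce C.supp).degree v ≤ K.degree v.1 := by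
      rw [← SimpleGraph.card_neighborFinset_eq_degree, ← SimpleGraph.card_neighborFinset_eq_degree]
      apply Finset.card_le_card_of_injOn (fun w => w.1)
      · intro w hw; simpa using hw
      · intro a _ b _ hab; exact Subtype.ext hab
    split_ifs with h
    · have := (hX _ h).2; omega
    · have := h2 v; omega
  have hsum := Finset.sum_le_sum (fun v (_ : v ∈ (Finset.univ : Finset C.supp)) => hd v)
  rw [Finset.sum_add_distrib, hs] at hsum
  have hx : ∑ v : C.supp, (if v.1 ∈ X then 1 else 0) = X.card := by
    rw [← Finset.card_filter]
    apply Finset.card_bij (fun w _ => w.1)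
    · intro w hw; simpa using hw
    · intro a _ b _ hab; exact Subtype.ext hab
    · intro b hb; exact ⟨⟨b, (hX b hb).1⟩, by simpa using hb, rfl⟩
  rw [hx] at hsum
  simp only [Finset.sum_const, Finset.card_univ, smul_eq_mul] at hsum
  rw [Nat.card_eq_fintype_card, Nat.card_eq_fintype_card] at h1
  have : (K.induce C.supp).edgeFinset.card = Fintype.card (K.induce C.supp).edgeSet := by
    rw [SimpleGraph.edgeFinset_card]
  omega

/-- The Kempe graph. -/
def kempe {V : Type*} (G : SimpleGraph V) (c : Sym2 V → ℕ) (i j : ℕ) : SimpleGraph V where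
  Adj a b := G.Adj a b ∧ (c s(a,b) = i ∨ c s(a,b) = j)
  symm := ⟨by intro a b h; rw [Sym2.eq_swap]; exact ⟨h.1.symm, h.2⟩⟩
  loopless := ⟨by intro a h; exact G.loopless.irrefl a h.1⟩

open Classical in
lemma kempe_deg {V : Type*} [Fintype V] (G : SimpleGraph V) (c : Sym2 V → ℕ) (h : PropC G c)
    (i j : ℕ) (v : V) (T : Finset ℕ)
    (hT : ∀ w, (kempe G c i j).Adj v w → c s(v,w) ∈ T) : (kempe G c i j).degree v ≤ T.card := by
  rw [← SimpleGraph.card_neighborFinset_eq_degree]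
  apply Finset.card_le_card_of_injOn (fun w => c s(v,w))
  · intro w hw
    exact hT w (by simpa using hw)
  · intro a ha b hb hab
    simp only [SimpleGraph.coe_neighborFinset, SimpleGraph.mem_neighborSet] at ha hb
    exact h v a b ha.1 hb.1 hab

open Classical in
/-- Swap colours on a set. -/
noncomputable def kswap {V : Type*} (c : Sym2 V → ℕ) (i j : ℕ) (C : Set V) : Sym2 V → ℕ :=
  fun e => if ∃ a ∈ e, a ∈ C then Equiv.swap i j (c e) else c e

open Classical in
lemma kswap_eq {V : Type*} (G : SimpleGraph V) (c : Sym2 V → ℕ) (i j : ℕ) (C : Set V)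
    (hC : ∀ a b, (kempe G c i j).Adj a b → a ∈ C → b ∈ C) (a b : V) (hab : G.Adj a b) :
    kswap c i j C s(a,b) = if a ∈ C then Equiv.swap i j (c s(a,b)) else c s(a,b) := by
  unfold kswap
  by_cases ha : a ∈ C
  · rw [if_pos ⟨a, by simp, ha⟩, if_pos ha]
  · rw [if_neg ha]
    split_ifs with h
    · obtain ⟨x, hx, hxC⟩ := h
      rcases Sym2.mem_iff.1 hx with rfl | rfl
      · exact absurd hxC ha
      · apply Equiv.swap_apply_of_ne_of_ne
        · intro h
          exact ha (hC x a (SimpleGraph.Adj.symm (⟨hab, Or.inl h⟩ : (kempe G c i j).Adj a x)) hxC)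
        · intro h
          exact ha (hC x a (SimpleGraph.Adj.symm (⟨hab, Or.inr h⟩ : (kempe G c i j).Adj a x)) hxC)
    · rfl

open Classical in
lemma kswap_prop {V : Type*} (G : SimpleGraph V) (c : Sym2 V → ℕ) (h : PropC G c)
    (i j : ℕ) (C : Set V)
    (hC : ∀ a b, (kempe G c i j).Adj a b → a ∈ C → b ∈ C) : PropC G (kswap c i j C) := by
  intro a b b' h1 h2 h3
  rw [kswap_eq G c i j C hC a b h1, kswap_eq G c i j C hC a b' h2] at h3
  split_ifs at h3
  · exact h a b b' h1 h2 ((Equiv.swap i j).injective h3)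
  · exact h a b b' h1 h2 h3

lemma swap_mem {S : Finset ℕ} {i j : ℕ} (hi : i ∈ S) (hj : j ∈ S) {t : ℕ} (ht : t ∈ S) :
    Equiv.swap i j t ∈ S := by
  rw [Equiv.swap_apply_def]; split_ifs <;> assumption

open Classical in
/-- number of vertices of N having i in the reserved list -/
noncomputable def cnt {V : Type*} (N : Finset V) (A : V → Finset ℕ) (i : ℕ) : ℕ :=
  (N.filter (fun u => i ∈ A u)).card

open Classical in
lemma kempe_step {V : Type*} [Fintype V] (G : SimpleGraph V) (N : Finset V) (S : Finset ℕ)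
    (c : Sym2 V → ℕ) (A : V → Finset ℕ) (hc : PropC G c) (hcS : ∀ a b, G.Adj a b → c s(a,b) ∈ S)
    (hA : ∀ u ∈ N, A u ⊆ S) (hm : ∀ u ∈ N, ∀ w, G.Adj u w → c s(u,w) ∉ A u)
    (i j : ℕ) (hi : i ∈ S) (hj : j ∈ S) (hij : cnt N A j + 3 ≤ cnt N A i) :
    ∃ (c' : Sym2 V → ℕ) (A' : V → Finset ℕ), PropC G c' ∧ (∀ a b, G.Adj a b → c' s(a,b) ∈ S) ∧
      (∀ u ∈ N, A' u ⊆ S) ∧ (∀ u ∈ N, ∀ w, G.Adj u w → c' s(u,w) ∉ A' u) ∧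
      (∀ u, (A' u).card = (A u).card) ∧
      ∑ l ∈ S, cnt N A' l ^ 2 < ∑ l ∈ S, cnt N A l ^ 2 := by
  have hne : i ≠ j := by rintro rfl; omega
  set K := kempe G c i j with hK
  let X : ℕ → Finset V := fun l => N.filter (fun u => l ∈ A u)
  obtain ⟨C, hCgt⟩ : ∃ C : K.ConnectedComponent,
      ((X j).filter (fun u => K.connectedComponentMk u = C)).card <
      ((X i).filter (fun u => K.connectedComponentMk u = C)).card := by
    by_contra hcon
    push Not at hcon
    have e1 := Finset.card_eq_sum_card_fiberwise (f := K.connectedComponentMk) (s := X i)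
      (t := Finset.univ) (by intro x _; simp)
    have e2 := Finset.card_eq_sum_card_fiberwise (f := K.connectedComponentMk) (s := X j)
      (t := Finset.univ) (by intro x _; simp)
    have := Finset.sum_le_sum (fun C (_ : C ∈ (Finset.univ : Finset K.ConnectedComponent)) => hcon C)
    have h1 : cnt N A i = (X i).card := rfl
    have h2 : cnt N A j = (X j).card := rfl
    omega
  have hle2 : ((X i).filter (fun u => K.connectedComponentMk u = C)).card ≤ 2 := by
    apply comp_ends K _ C
    · intro v hv
      simp only [X, Finset.mem_filter] at hv
      refine ⟨hv.2, ?_⟩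
      have := kempe_deg G c hc i j v {j} (by
        intro w hw
        rcases hw.2 with h | h
        · exact absurd (h ▸ hv.1.2) (hm v hv.1.1 w hw.1)
        · simp [h])
      simpa using this
    · intro v
      have := kempe_deg G c hc i j v {i, j} (by
        intro w hw
        rcases hw.2 with h | h <;> simp [h])
      exact this.trans Finset.card_le_two
  have hCcl : ∀ a b, K.Adj a b → a ∈ C.supp → b ∈ C.supp := by
    intro a b hab ha
    rw [SimpleGraph.ConnectedComponent.mem_supp_iff] at ha ⊢
    rw [← ha]
    exact (SimpleGraph.ConnectedComponent.sound hab.reachable).symm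
  let A' : V → Finset ℕ := fun u => if u ∈ C.supp then (A u).map (Equiv.swap i j).toEmbedding else A u
  have hmem : ∀ u l, l ∈ A' u ↔ if u ∈ C.supp then Equiv.swap i j l ∈ A u else l ∈ A u := by
    intro u l
    simp only [A']
    split_ifs
    · rw [Finset.mem_map_equiv, Equiv.symm_swap]
    · rfl
  refine ⟨kswap c i j C.supp, A', kswap_prop G c hc i j _ hCcl, ?_, ?_, ?_, ?_, ?_⟩
  · intro a b hab
    rw [kswap_eq G c i j _ hCcl a b hab]
    split_ifs
    · exact swap_mem hi hj (hcS a b hab)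
    · exact hcS a b hab
  · intro u hu l hl
    rw [hmem] at hl
    split_ifs at hl
    · have := swap_mem hi hj (hA u hu hl)
      simpa using this
    · exact hA u hu hl
  · intro u hu w hw
    rw [kswap_eq G c i j _ hCcl u w hw, hmem]
    split_ifs
    · simpa using hm u hu w hw
    · exact hm u hu w hw
  · intro u
    simp only [A']
    split_ifs
    · rw [Finset.card_map]
    · rfl
  · -- count
    have split : ∀ B : V → Finset ℕ, ∀ l, cnt N B l =
        (N.filter (fun u => l ∈ B u ∧ u ∈ C.supp)).card +
        (N.filter (fun u => l ∈ B u ∧ ¬ u ∈ C.supp)).card := by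
      intro B l
      unfold cnt
      rw [← Finset.card_filter_add_card_filter_not (fun u => u ∈ C.supp), Finset.filter_filter,
        Finset.filter_filter]
    have q1 : ∀ l, (N.filter (fun u => l ∈ A' u ∧ u ∈ C.supp)).card =
        (N.filter (fun u => Equiv.swap i j l ∈ A u ∧ u ∈ C.supp)).card := by
      intro l
      congr 1
      apply Finset.filter_congr
      intro u _
      rw [hmem]
      by_cases h : u ∈ C.supp <;> simp [h]
    have q2 : ∀ l, (N.filter (fun u => l ∈ A' u ∧ ¬ u ∈ C.supp)).card =
        (N.filter (fun u => l ∈ A u ∧ ¬ u ∈ C.supp)).card := by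
      intro l
      congr 1
      apply Finset.filter_congr
      intro u _
      rw [hmem]
      by_cases h : u ∈ C.supp <;> simp [h]
    have q3 : ∀ l, ((X l).filter (fun u => K.connectedComponentMk u = C)).card =
        (N.filter (fun u => l ∈ A u ∧ u ∈ C.supp)).card := by
      intro l
      simp only [X]
      rw [Finset.filter_filter]
      congr 1
      ext u
      simp only [Finset.mem_filter, SimpleGraph.ConnectedComponent.mem_supp_iff]
    rw [q3] at hle2
    rw [q3, q3] at hCgt
    have hj' : j ∈ S.erase i := Finset.mem_erase.2 ⟨hne.symm, hj⟩
    rw [← Finset.add_sum_erase S _ hi, ← Finset.add_sum_erase S _ hi,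
      ← Finset.add_sum_erase _ _ hj', ← Finset.add_sum_erase _ _ hj']
    have hrest : ∑ l ∈ (S.erase i).erase j, cnt N A' l ^ 2 =
        ∑ l ∈ (S.erase i).erase j, cnt N A l ^ 2 := by
      apply Finset.sum_congr rfl
      intro l hl
      simp only [Finset.mem_erase] at hl
      rw [split A', split A, q1, q2, Equiv.swap_apply_of_ne_of_ne hl.2.1 hl.1]
    rw [hrest]
    have ei := split A' i
    have ej := split A' j
    rw [q1, q2, Equiv.swap_apply_left] at ei
    rw [q1, q2, Equiv.swap_apply_right] at ej
    have fi := split A i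
    have fj := split A j
    set a := (N.filter (fun u => i ∈ A u ∧ u ∈ C.supp)).card
    set b := (N.filter (fun u => j ∈ A u ∧ u ∈ C.supp)).card
    rw [ei, ej]
    rw [fi, fj] at hij ⊢
    set x := (N.filter (fun u => i ∈ A u ∧ ¬ u ∈ C.supp)).card
    set y := (N.filter (fun u => j ∈ A u ∧ ¬ u ∈ C.supp)).card
    have hxy : y < x := by omega
    nlinarith [Nat.mul_lt_mul_of_lt_of_lt hCgt hxy, mul_add_mul_lt_mul_add_mul hCgt hxy]

open Classical in
lemma sum_cnt {V : Type*} (N : Finset V) (S : Finset ℕ) (A : V → Finset ℕ)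
    (hA : ∀ u ∈ N, A u ⊆ S) : ∑ l ∈ S, cnt N A l = ∑ u ∈ N, (A u).card := by
  unfold cnt
  simp_rw [Finset.card_filter]
  rw [Finset.sum_comm]
  apply Finset.sum_congr rfl
  intro u hu
  rw [← Finset.card_filter]
  congr 1
  ext l
  simp only [Finset.mem_filter]
  exact ⟨fun h => h.2, fun h => ⟨hA u hu h, h⟩⟩

open Classical in
lemma vizing_core {V : Type*} [Fintype V] (n : ℕ) : ∀ (m : ℕ) (G : SimpleGraph V) (N : Finset V)
    (S : Finset ℕ) (c : Sym2 V → ℕ) (A : V → Finset ℕ) (u0 : V), N.card = n → N.card ≤ S.card →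
    PropC G c → (∀ a b, G.Adj a b → c s(a,b) ∈ S) →
    (∀ u ∈ N, A u ⊆ S) → (∀ u ∈ N, ∀ w, G.Adj u w → c s(u,w) ∉ A u) →
    (∀ u ∈ N, u ≠ u0 → (A u).card = 2) → (u0 ∈ N) → ((A u0).card = 1) →
    ∑ l ∈ S, cnt N A l ^ 2 = m →
    ∃ (c' : Sym2 V → ℕ) (g : V → ℕ), PropC G c' ∧ (∀ a b, G.Adj a b → c' s(a,b) ∈ S) ∧
      Set.InjOn g N ∧ ∀ u ∈ N, g u ∈ S ∧ ∀ w, G.Adj u w → c' s(u,w) ≠ g u := by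
  induction n with
  | zero =>
    intro m G N S c A u0 h0 _ _ _ _ _ _ hu0
    rw [Finset.card_eq_zero] at h0
    simp [h0] at hu0
  | succ n ih =>
    intro m
    induction m using Nat.strong_induction_on with
    | _ m ihm =>
    intro G N S c A u0 hN hNS hc hcS hA hm h2 hu0 h1 hΦ
    by_cases hex : ∃ i ∈ S, cnt N A i = 1
    · obtain ⟨i, hi, hcnt⟩ := hex
      obtain ⟨u, hu⟩ := Finset.card_eq_one.1 hcnt
      have huN : u ∈ N ∧ i ∈ A u := by
        have : u ∈ N.filter (fun u => i ∈ A u) := by rw [hu]; simp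
        simpa using this
      have huniq : ∀ w ∈ N, w ≠ u → i ∉ A w := by
        intro w hw hne hiw
        have : w ∈ N.filter (fun u => i ∈ A u) := by simp [hw, hiw]
        rw [hu] at this
        exact hne (by simpa using this)
      let G' : SimpleGraph V :=
        { Adj := fun a b => G.Adj a b ∧ c s(a,b) ≠ i
          symm := ⟨by intro a b h; rw [Sym2.eq_swap]; exact ⟨h.1.symm, h.2⟩⟩
          loopless := ⟨by intro a h; exact G.loopless.irrefl a h.1⟩ }
      have hN' : (N.erase u).card = n := by rw [Finset.card_erase_of_mem huN.1]; omega
      have hS' : (S.erase i).card + 1 = S.card := Finset.card_erase_add_one hi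
      -- the smaller instance
      obtain ⟨c', g, p1, p2, p3, p4⟩ : ∃ (c' : Sym2 V → ℕ) (g : V → ℕ), PropC G' c' ∧
          (∀ a b, G'.Adj a b → c' s(a,b) ∈ S.erase i) ∧ Set.InjOn g (N.erase u : Finset V) ∧
          ∀ w ∈ N.erase u, g w ∈ S.erase i ∧ ∀ z, G'.Adj w z → c' s(w,z) ≠ g w := by
        have hcS' : ∀ a b, G'.Adj a b → c s(a,b) ∈ S.erase i := by
          intro a b hab
          exact Finset.mem_erase.2 ⟨hab.2, hcS a b hab.1⟩
        have hc' : PropC G' c := fun a b b' h h' => hc a b b' h.1 h'.1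
        by_cases hemp : N.erase u = ∅
        · refine ⟨c, fun _ => 0, hc', hcS', ?_, ?_⟩
          · rw [hemp]; simp
          · rw [hemp]; simp
        · have hA' : ∀ w ∈ N.erase u, A w ⊆ S.erase i := by
            intro w hw l hl
            rw [Finset.mem_erase] at hw
            refine Finset.mem_erase.2 ⟨?_, hA w hw.2 hl⟩
            rintro rfl
            exact huniq w hw.2 hw.1 hl
          by_cases huu : u = u0
          · subst huu
            obtain ⟨u1, hu1⟩ := Finset.nonempty_iff_ne_empty.2 hemp
            have hu1' := Finset.mem_erase.1 hu1
            obtain ⟨t, ht⟩ : (A u1).Nonempty := by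
              rw [← Finset.card_pos, h2 u1 hu1'.2 hu1'.1]; norm_num
            refine ih _ G' (N.erase u) (S.erase i) c (fun w => if w = u1 then {t} else A w) u1
              hN' (by omega) hc' hcS' ?_ ?_ ?_ hu1 (by simp) rfl
            · intro w hw
              by_cases hwu : w = u1
              · subst hwu
                simpa using Finset.mem_erase.1 (hA' w hw ht)
              · simp only [hwu, if_false]; exact hA' w hw
            · intro w hw z hz
              have hmz := hm w (Finset.mem_erase.1 hw).2 z hz.1
              by_cases hwu : w = u1
              · subst hwu
                simp only [if_true, Finset.mem_singleton]
                rintro rfl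
                exact hmz ht
              · simp only [hwu, if_false]; exact hmz
            · intro w hw hne
              simp only [hne, if_false]
              exact h2 w (Finset.mem_erase.1 hw).2 (Finset.mem_erase.1 hw).1
          · exact ih _ G' (N.erase u) (S.erase i) c A u0 hN' (by omega) hc' hcS' hA'
              (fun w hw z hz => hm w (Finset.mem_erase.1 hw).2 z hz.1)
              (fun w hw => h2 w (Finset.mem_erase.1 hw).2)
              (Finset.mem_erase.2 ⟨fun h => huu h.symm, hu0⟩) h1 rfl
      refine ⟨fun e => if c e = i then i else c' e, fun w => if w = u then i else g w, ?_, ?_, ?_, ?_⟩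
      · intro a b b' hab hab' heq
        dsimp only at heq
        by_cases e1 : c s(a,b) = i <;> by_cases e2 : c s(a,b') = i
        · exact hc a b b' hab hab' (e1.trans e2.symm)
        · rw [if_pos e1, if_neg e2] at heq
          exact absurd heq.symm (Finset.mem_erase.1 (p2 a b' ⟨hab', e2⟩)).1
        · rw [if_neg e1, if_pos e2] at heq
          exact absurd heq (Finset.mem_erase.1 (p2 a b ⟨hab, e1⟩)).1
        · rw [if_neg e1, if_neg e2] at heq
          exact p1 a b b' ⟨hab, e1⟩ ⟨hab', e2⟩ heq
      · intro a b hab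
        dsimp only
        split_ifs with e1
        · exact hi
        · exact (Finset.mem_erase.1 (p2 a b ⟨hab, e1⟩)).2
      · intro a ha b hb heq
        dsimp only at heq
        have ha' : a ∈ N := ha
        have hb' : b ∈ N := hb
        by_cases e1 : a = u <;> by_cases e2 : b = u
        · rw [e1, e2]
        · rw [if_pos e1, if_neg e2] at heq
          exact absurd heq.symm (Finset.mem_erase.1 (p4 b (Finset.mem_erase.2 ⟨e2, hb'⟩)).1).1
        · rw [if_neg e1, if_pos e2] at heq
          exact absurd heq (Finset.mem_erase.1 (p4 a (Finset.mem_erase.2 ⟨e1, ha'⟩)).1).1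
        · rw [if_neg e1, if_neg e2] at heq
          exact p3 (Finset.mem_coe.2 (Finset.mem_erase.2 ⟨e1, ha'⟩))
            (Finset.mem_coe.2 (Finset.mem_erase.2 ⟨e2, hb'⟩)) heq
      · intro w hw
        by_cases e1 : w = u
        · subst e1
          simp only [if_true]
          refine ⟨hi, ?_⟩
          intro z hz
          have hne : c s(w,z) ≠ i := by
            intro h
            exact hm w hw z hz (h ▸ huN.2)
          rw [if_neg hne]
          exact (Finset.mem_erase.1 (p2 w z ⟨hz, hne⟩)).1
        · simp only [e1, if_false]
          have hp := p4 w (Finset.mem_erase.2 ⟨e1, hw⟩)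
          refine ⟨(Finset.mem_erase.1 hp.1).2, ?_⟩
          intro z hz
          split_ifs with e2
          · exact (Finset.mem_erase.1 hp.1).1.symm
          · exact hp.2 z ⟨hz, e2⟩
    · push Not at hex
      have hsum := sum_cnt N S A hA
      have hcard : ∑ u ∈ N, (A u).card + 1 = 2 * N.card := by
        rw [← Finset.add_sum_erase N _ hu0, h1]
        have : ∑ u ∈ N.erase u0, (A u).card = ∑ u ∈ N.erase u0, 2 :=
          Finset.sum_congr rfl (fun u hu =>
            h2 u (Finset.mem_erase.1 hu).2 (Finset.mem_erase.1 hu).1)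
        rw [this, Finset.sum_const, smul_eq_mul, Finset.card_erase_of_mem hu0]
        omega
      obtain ⟨j, hj, hj0⟩ : ∃ j ∈ S, cnt N A j = 0 := by
        by_contra hcon
        push Not at hcon
        have : ∑ l ∈ S, 2 ≤ ∑ l ∈ S, cnt N A l := by
          apply Finset.sum_le_sum
          intro l hl
          have := hcon l hl
          have := hex l hl
          omega
        rw [Finset.sum_const, smul_eq_mul] at this
        omega
      obtain ⟨i, hi, hi3⟩ : ∃ i ∈ S, 3 ≤ cnt N A i := by
        by_contra hcon
        push Not at hcon
        have : 2 ∣ ∑ l ∈ S, cnt N A l := by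
          apply Finset.dvd_sum
          intro l hl
          have h1 := hcon l hl
          have h2 := hex l hl
          omega
        omega
      obtain ⟨c', A', r1, r2, r3, r4, r5, r6⟩ :=
        kempe_step G N S c A hc hcS hA hm i j hi hj (by omega)
      rw [hΦ] at r6
      exact ihm _ r6 G N S c' A' u0 hN hNS r1 r2 r3 r4
        (fun u hu hne => (r5 u).trans (h2 u hu hne)) hu0 ((r5 u0).trans h1) rfl

open Classical in
/-- Vizing's theorem. -/
theorem vizing {V : Type*} [Fintype V] (G : SimpleGraph V) (d : ℕ)
    (hd : ∀ v, vertDegree G v ≤ d) :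
    ∃ c : Sym2 V → ℕ, PropC G c ∧ ∀ a b, G.Adj a b → c s(a,b) < d + 1 := by
  have hdeg : ∀ v, (G.neighborFinset v).card ≤ d := by
    intro v
    have := hd v
    unfold vertDegree at this
    rwa [← SimpleGraph.coe_neighborFinset, Set.ncard_coe_finset] at this
  suffices H : ∀ T : Finset V, ∃ c : Sym2 V → ℕ,
      (∀ a b b', a ∈ T → b ∈ T → b' ∈ T → G.Adj a b → G.Adj a b' → c s(a,b) = c s(a,b') → b = b') ∧
      ∀ a b, a ∈ T → b ∈ T → G.Adj a b → c s(a,b) ∈ Finset.range (d+1) by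
    obtain ⟨c, h1, h2⟩ := H Finset.univ
    refine ⟨c, fun a b b' => h1 a b b' (by simp) (by simp) (by simp), fun a b hab => ?_⟩
    simpa using h2 a b (by simp) (by simp) hab
  intro T
  induction T using Finset.induction_on with
  | empty => exact ⟨fun _ => 0, by simp, by simp⟩
  | insert v T hv ih =>
    obtain ⟨c, h1, h2⟩ := ih
    let G' : SimpleGraph V :=
      { Adj := fun a b => G.Adj a b ∧ a ∈ T ∧ b ∈ T
        symm := ⟨fun a b h => ⟨h.1.symm, h.2.2, h.2.1⟩⟩
        loopless := ⟨fun a h => G.loopless.irrefl a h.1⟩ }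
    let N := (G.neighborFinset v).filter (· ∈ T)
    have hNmem : ∀ u, u ∈ N ↔ G.Adj v u ∧ u ∈ T := by intro u; simp [N]
    have hc : PropC G' c := fun a b b' h h' => h1 a b b' h.2.1 h.2.2 h'.2.2 h.1 h'.1
    have hcS : ∀ a b, G'.Adj a b → c s(a,b) ∈ Finset.range (d+1) :=
      fun a b h => h2 a b h.2.1 h.2.2 h.1
    obtain ⟨c', g, p1, p2, p3, p4⟩ : ∃ (c' : Sym2 V → ℕ) (g : V → ℕ), PropC G' c' ∧
          (∀ a b, G'.Adj a b → c' s(a,b) ∈ Finset.range (d+1)) ∧ Set.InjOn g N ∧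
          ∀ u ∈ N, g u ∈ Finset.range (d+1) ∧ ∀ w, G'.Adj u w → c' s(u,w) ≠ g u := by
      by_cases hemp : N = ∅
      · exact ⟨c, fun _ => 0, hc, hcS, by simp [hemp], by simp [hemp]⟩
      obtain ⟨u0, hu0⟩ := Finset.nonempty_iff_ne_empty.2 hemp
      have hfree : ∀ u, ∃ B : Finset ℕ, u ∈ N → B ⊆ Finset.range (d+1) ∧
          (∀ w, G'.Adj u w → c s(u,w) ∉ B) ∧ B.card = if u = u0 then 1 else 2 := by
        intro u
        by_cases hu : u ∈ N
        swap
        · exact ⟨∅, fun h => absurd h hu⟩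
        let P := ((G.neighborFinset u).erase v).image (fun w => c s(u,w))
        have hP : P.card + 1 ≤ d := by
          have e1 : P.card ≤ ((G.neighborFinset u).erase v).card := Finset.card_image_le
          have e2 : ((G.neighborFinset u).erase v).card + 1 = (G.neighborFinset u).card :=
            Finset.card_erase_add_one (by simpa using ((hNmem u).1 hu).1.symm)
          have := hdeg u
          omega
        have hge : (if u = u0 then 1 else 2) ≤ (Finset.range (d+1) \ P).card := by
          have := Finset.le_card_sdiff P (Finset.range (d+1))
          rw [Finset.card_range] at this
          split_ifs <;> omega
        obtain ⟨B, hB, hBc⟩ := Finset.exists_subset_card_eq hge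
        refine ⟨B, fun _ => ⟨fun l hl => (Finset.mem_sdiff.1 (hB hl)).1, ?_, hBc⟩⟩
        intro w hw hmem
        apply (Finset.mem_sdiff.1 (hB hmem)).2
        apply Finset.mem_image_of_mem (fun w => c s(u,w))
        rw [Finset.mem_erase]
        refine ⟨?_, by simpa using hw.1⟩
        rintro rfl
        exact hv hw.2.2
      choose A hAall using hfree
      refine vizing_core N.card _ G' N (Finset.range (d+1)) c A u0 rfl ?_ hc hcS
        (fun u hu => (hAall u hu).1) (fun u hu => (hAall u hu).2.1) ?_ hu0 ?_ rfl
      · rw [Finset.card_range]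
        have e1 : N.card ≤ (G.neighborFinset v).card := Finset.card_filter_le _ _
        have := hdeg v
        omega
      · intro u hu hne
        rw [(hAall u hu).2.2, if_neg hne]
      · rw [(hAall u0 hu0).2.2, if_pos rfl]
    -- extend
    let φ : V → V → ℕ := fun a b => if a = v then g b else if b = v then g a else c' s(a,b)
    have hne : ∀ a ∈ T, a ≠ v := by rintro a ha rfl; exact hv ha
    have hφ : ∃ F : Sym2 V → ℕ, (∀ b ∈ T, F s(v,b) = g b) ∧ (∀ b ∈ T, F s(b,v) = g b) ∧
        ∀ a ∈ T, ∀ b ∈ T, F s(a,b) = c' s(a,b) := by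
      refine ⟨Sym2.lift ⟨φ, ?_⟩, ?_, ?_, ?_⟩
      · intro a b
        simp only [φ]
        by_cases ha : a = v <;> by_cases hb : b = v
        · rw [ha, hb]
        · simp [ha, hb]
        · simp [ha, hb]
        · simp only [ha, hb, if_false]; rw [Sym2.eq_swap]
      · intro b hb; simp [φ]
      · intro b hb; simp [φ, hne b hb]
      · intro a ha b hb; simp [φ, hne b hb, hne a ha]
    obtain ⟨F, F1, F2, F3⟩ := hφ
    refine ⟨F, ?_, ?_⟩
    · intro a b b' ha hb hb' hab hab' heq
      rcases Finset.mem_insert.1 ha with rfl | haT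
      · rcases Finset.mem_insert.1 hb with rfl | hb
        · exact absurd hab (G.loopless.irrefl _)
        rcases Finset.mem_insert.1 hb' with rfl | hb'
        · exact absurd hab' (G.loopless.irrefl _)
        rw [F1 b hb, F1 b' hb'] at heq
        exact p3 (Finset.mem_coe.2 ((hNmem b).2 ⟨hab, hb⟩))
          (Finset.mem_coe.2 ((hNmem b').2 ⟨hab', hb'⟩)) heq
      · rcases Finset.mem_insert.1 hb with rfl | hbT <;> rcases Finset.mem_insert.1 hb' with rfl | hb'
        · rfl
        · rw [F2 a haT, F3 a haT b' hb'] at heq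
          exact absurd heq.symm ((p4 a ((hNmem a).2 ⟨hab.symm, haT⟩)).2 b' ⟨hab', haT, hb'⟩)
        · rw [F2 a haT, F3 a haT b hbT] at heq
          exact absurd heq ((p4 a ((hNmem a).2 ⟨hab'.symm, haT⟩)).2 b ⟨hab, haT, hbT⟩)
        · rw [F3 a haT b hbT, F3 a haT b' hb'] at heq
          exact p1 a b b' ⟨hab, haT, hbT⟩ ⟨hab', haT, hb'⟩ heq
    · intro a b ha hb hab
      rcases Finset.mem_insert.1 ha with rfl | haT <;> rcases Finset.mem_insert.1 hb with rfl | hb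
      · exact absurd hab (G.loopless.irrefl _)
      · rw [F1 b hb]; exact (p4 b ((hNmem b).2 ⟨hab, hb⟩)).1
      · rw [F2 a haT]; exact (p4 a ((hNmem a).2 ⟨hab.symm, haT⟩)).1
      · rw [F3 a haT b hb]; exact p2 a b ⟨hab, haT, hb⟩

lemma box_deg {V W : Type*} [Finite V] [Finite W] (G : SimpleGraph V) (H : SimpleGraph W)
    (x : V × W) : vertDegree (G □ H) x = vertDegree G x.1 + vertDegree H x.2 := by
  unfold vertDegree
  rw [SimpleGraph.neighborSet_boxProd, Set.ncard_union_eq, Set.ncard_prod, Set.ncard_prod]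
  · simp
  · rw [Set.disjoint_left]
    rintro ⟨a, b⟩ h1 h2
    simp only [Set.mem_prod, Set.mem_singleton_iff, SimpleGraph.mem_neighborSet] at h1 h2
    exact G.loopless.irrefl _ (h2.1 ▸ h1.1)

/-- A class 1 regular graph has a colouring in which every vertex sees every colour. -/
lemma class1_col {V : Type*} [Fintype V] [Nonempty V] (G : SimpleGraph V) (r : ℕ)
    (hreg : IsRegularDeg G r) (hr : 2 ≤ r) (h1 : IsClass1 G) :
    ∃ f, PropC G f ∧ ∀ v, palette G f v = Set.Iio r := by
  have hm : maxDeg G = r := by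
    unfold maxDeg
    have : Set.range (vertDegree G) = {r} := by
      rw [show vertDegree G = fun _ => r from funext hreg, Set.range_const]
    rw [this, csSup_singleton]
  rw [IsClass1, hm] at h1
  have hne : {n | ∃ f, IsProperEdgeColoring G f ∧ ∀ e ∈ G.edgeSet, f e < n}.Nonempty := by
    by_contra hcon
    rw [Set.not_nonempty_iff_eq_empty] at hcon
    rw [chromIndex, hcon, Nat.sInf_empty] at h1
    omega
  have hmem := Nat.sInf_mem hne
  have h1' : sInf {n | ∃ f, IsProperEdgeColoring G f ∧ ∀ e ∈ G.edgeSet, f e < n} = r := h1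
  rw [h1'] at hmem
  obtain ⟨f, hf, hlt⟩ := hmem
  rw [propC_iff] at hf
  refine ⟨f, hf, fun v => ?_⟩
  apply Set.eq_of_subset_of_ncard_le
  · rintro t ⟨e, he, _, rfl⟩
    exact hlt e he
  · rw [pal_ncard G f hf, hreg v]
    rw [← Finset.coe_Iio, Set.ncard_coe_finset]; simp
  · exact Set.finite_Iio r

lemma reg_col {W : Type*} [Fintype W] (H : SimpleGraph W) (s : ℕ) (hreg : IsRegularDeg H s) :
    ∃ (h : Sym2 W → ℕ) (m : W → ℕ), PropC H h ∧ (∀ x, m x < s + 1) ∧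
      ∀ x, palette H h x = Set.Iio (s+1) \ {m x} := by
  obtain ⟨h, hp, hlt⟩ := vizing H s (fun v => (hreg v).le)
  have hsub : ∀ x, palette H h x ⊆ Set.Iio (s+1) := by
    intro x t ht
    obtain ⟨w, hw, rfl⟩ := (mem_pal _ _ _ _).1 ht
    exact hlt x w hw
  have hc : (Set.Iio (s+1)).ncard = s + 1 := by
    rw [← Finset.coe_Iio, Set.ncard_coe_finset]; simp
  have : ∀ x, ∃ t, Set.Iio (s+1) \ palette H h x = {t} := by
    intro x
    rw [← Set.ncard_eq_one, Set.ncard_sdiff (hsub x) ((Set.finite_Iio _).subset (hsub x)), hc,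
      pal_ncard H h hp, hreg x]
    omega
  choose m hm using this
  refine ⟨h, m, hp, ?_, ?_⟩
  · intro x
    have : m x ∈ Set.Iio (s+1) \ palette H h x := by rw [hm x]; rfl
    exact this.1
  · intro x
    rw [← hm x]
    ext t
    have := @hsub x t
    simp only [Set.mem_sdiff]
    tauto

open Classical in
lemma exists_col {V W : Type*} [Fintype V] [Fintype W] [Nonempty V]
    (G : SimpleGraph V) (H : SimpleGraph W) (r s : ℕ)
    (hGreg : IsRegularDeg G r) (hr : 2 ≤ r) (hHreg : IsRegularDeg H s)
    (hG1 : IsClass1 G) (e : Sym2 V) :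
    ∃ F, PropC ((G.deleteEdges {e}) □ H) F ∧ numPalettes ((G.deleteEdges {e}) □ H) F ≤ 2 := by
  obtain ⟨f, hf, hfp⟩ := class1_col G r hGreg hr hG1
  obtain ⟨h, m, hh, hm, hhp⟩ := reg_col H s hHreg
  obtain ⟨q, hqr, hqe⟩ : ∃ q, q < r ∧ q ≠ f e := by
    by_cases h0 : f e = 0
    · exact ⟨1, by omega, by omega⟩
    · exact ⟨0, by omega, fun h => h0 h.symm⟩
  -- colour of a `G`-edge in the fibre over `x`
  let γ : W → ℕ → ℕ := fun x t => if t = q then m x else s + 1 + t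
  have γinj : ∀ x t t', γ x t = γ x t' → t = t' := by
    intro x t t' h
    have := hm x
    simp only [γ] at h
    split_ifs at h <;> omega
  let φ : V × W → V × W → ℕ := fun a b =>
    if a.2 = b.2 then γ a.2 (f s(a.1,b.1)) else h s(a.2,b.2)
  have hφ : ∀ a b, φ a b = φ b a := by
    intro a b
    simp only [φ]
    by_cases hab : a.2 = b.2
    · rw [if_pos hab, if_pos hab.symm, hab, Sym2.eq_swap]
    · rw [if_neg hab, if_neg (fun h => hab h.symm), Sym2.eq_swap]
  let F : Sym2 (V × W) → ℕ := Sym2.lift ⟨φ, hφ⟩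
  have F1 : ∀ a b x, F s((a,x),(b,x)) = γ x (f s(a,b)) := by
    intro a b x; simp [F, φ]
  have F2 : ∀ a x y, H.Adj x y → F s((a,x),(a,y)) = h s(x,y) := by
    intro a x y hxy; simp [F, φ, hxy.ne]
  have hlt : ∀ x y, H.Adj x y → h s(x,y) < s + 1 ∧ h s(x,y) ≠ m x := by
    intro x y hxy
    have : h s(x,y) ∈ palette H h x := (mem_pal _ _ _ _).2 ⟨y, hxy, rfl⟩
    rw [hhp x] at this
    exact this
  have hγh : ∀ x y t, H.Adj x y → γ x t ≠ h s(x,y) := by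
    intro x y t hxy
    have := hlt x y hxy
    simp only [γ]
    split_ifs <;> omega
  have hadj : ∀ a b, (G.deleteEdges {e}).Adj a b ↔ G.Adj a b ∧ s(a,b) ≠ e := by
    intro a b; simp [SimpleGraph.deleteEdges_adj]
  refine ⟨F, ?_, ?_⟩
  · rintro ⟨a, x⟩ ⟨b, y⟩ ⟨b', y'⟩ h1 h2 heq
    rw [SimpleGraph.boxProd_adj] at h1 h2
    dsimp only at h1 h2
    rcases h1 with ⟨h1, rfl⟩ | ⟨h1, rfl⟩ <;> rcases h2 with ⟨h2, rfl⟩ | ⟨h2, rfl⟩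
    · rw [F1, F1] at heq
      rw [hf a b b' ((hadj _ _).1 h1).1 ((hadj _ _).1 h2).1 (γinj _ _ _ heq)]
    · rw [F1, F2 _ _ _ h2] at heq
      exact absurd heq (hγh _ _ _ h2)
    · rw [F1, F2 _ _ _ h1] at heq
      exact absurd heq.symm (hγh _ _ _ h1)
    · rw [F2 _ _ _ h1, F2 _ _ _ h2] at heq
      rw [hh x y y' h1 h2 heq]
  · let P : Set ℕ := {t | t < s + 1 ∨ ∃ l < r, l ≠ q ∧ t = s + 1 + l}
    have hsub : Set.range (palette ((G.deleteEdges {e}) □ H) F) ⊆ {P, P \ {s + 1 + f e}} := by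
      rintro _ ⟨⟨a, x⟩, rfl⟩
      have key : ∀ t, t ∈ palette ((G.deleteEdges {e}) □ H) F (a,x) ↔
          (∃ b, G.Adj a b ∧ s(a,b) ≠ e ∧ γ x (f s(a,b)) = t) ∨ (t < s + 1 ∧ t ≠ m x) := by
        intro t
        have e1 : (t < s + 1 ∧ t ≠ m x) ↔ t ∈ palette H h x := by rw [hhp x]; rfl
        rw [e1, mem_pal, mem_pal]
        constructor
        · rintro ⟨⟨b, y⟩, hab, rfl⟩
          rw [SimpleGraph.boxProd_adj] at hab
          dsimp only at hab
          rcases hab with ⟨h1, rfl⟩ | ⟨h1, rfl⟩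
          · exact Or.inl ⟨b, ((hadj _ _).1 h1).1, ((hadj _ _).1 h1).2, (F1 _ _ _).symm⟩
          · exact Or.inr ⟨y, h1, (F2 _ _ _ h1).symm⟩
        · rintro (⟨b, h1, h2, rfl⟩ | ⟨y, h1, rfl⟩)
          · refine ⟨(b,x), ?_, F1 _ _ _⟩
            rw [SimpleGraph.boxProd_adj]
            exact Or.inl ⟨(hadj _ _).2 ⟨h1, h2⟩, rfl⟩
          · refine ⟨(a,y), ?_, F2 _ _ _ h1⟩
            rw [SimpleGraph.boxProd_adj]
            exact Or.inr ⟨h1, rfl⟩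
      have see : ∀ l, l < r ↔ ∃ b, G.Adj a b ∧ f s(a,b) = l := by
        intro l
        rw [← mem_pal, hfp a]; rfl
      -- rewrite the first disjunct in terms of colours
      have key2 : ∀ t, t ∈ palette ((G.deleteEdges {e}) □ H) F (a,x) ↔
          (∃ l < r, (∀ b, G.Adj a b → f s(a,b) = l → s(a,b) ≠ e) ∧ γ x l = t) ∨
            (t < s + 1 ∧ t ≠ m x) := by
        intro t
        rw [key]
        refine or_congr_left ?_
        constructor
        · rintro ⟨b, h1, h2, h3⟩
          refine ⟨f s(a,b), (see _).2 ⟨b, h1, rfl⟩, ?_, h3⟩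
          intro b' hb' heq
          rw [hf a b' b hb' h1 heq]; exact h2
        · rintro ⟨l, hl, h1, h2⟩
          obtain ⟨b, hb, rfl⟩ := (see l).1 hl
          exact ⟨b, hb, h1 b hb rfl, h2⟩
      have hmx := hm x
      by_cases hae : ∃ b, G.Adj a b ∧ s(a,b) = e
      · right
        obtain ⟨b0, hb0, rfl⟩ := hae
        have hiff : ∀ l, (∀ b, G.Adj a b → f s(a,b) = l → s(a,b) ≠ s(a,b0)) ↔ l ≠ f s(a,b0) := by
          intro l
          constructor
          · rintro h rfl
            exact h b0 hb0 rfl rfl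
          · rintro h b _ rfl heq
            exact h (by rw [heq])
        ext t
        rw [key2]
        simp only [hiff, P, Set.mem_sdiff, Set.mem_singleton_iff, Set.mem_ofPred_eq, γ]
        constructor
        · rintro (⟨l, hl, h1, h2⟩ | ⟨h1, h2⟩)
          · split_ifs at h2 with hlq
            · exact ⟨Or.inl (by omega), by omega⟩
            · exact ⟨Or.inr ⟨l, hl, hlq, h2.symm⟩, by omega⟩
          · exact ⟨Or.inl h1, by omega⟩
        · rintro ⟨h1 | ⟨l, hl, hlq, rfl⟩, h2⟩
          · by_cases htm : t = m x
            · exact Or.inl ⟨q, hqr, hqe, by simp [htm]⟩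
            · exact Or.inr ⟨h1, htm⟩
          · exact Or.inl ⟨l, hl, by omega, by simp [hlq]⟩
      · left
        push Not at hae
        ext t
        rw [key2]
        simp only [P, Set.mem_ofPred_eq, γ]
        constructor
        · rintro (⟨l, hl, h1, h2⟩ | ⟨h1, h2⟩)
          · split_ifs at h2 with hlq
            · exact Or.inl (by omega)
            · exact Or.inr ⟨l, hl, hlq, h2.symm⟩
          · exact Or.inl h1
        · rintro (h1 | ⟨l, hl, hlq, rfl⟩)
          · by_cases htm : t = m x
            · exact Or.inl ⟨q, hqr, fun b hb _ => hae b hb, by simp [htm]⟩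
            · exact Or.inr ⟨h1, htm⟩
          · exact Or.inl ⟨l, hl, fun b hb _ => hae b hb, by simp [hlq]⟩
    unfold numPalettes
    refine (Set.ncard_le_ncard hsub (Set.toFinite _)).trans ?_
    exact (Set.ncard_insert_le _ _).trans (by rw [Set.ncard_singleton])

lemma two_le {V W : Type*} [Fintype V] [Fintype W]
    (G : SimpleGraph V) (H : SimpleGraph W) (r s : ℕ) (x : W)
    (hGreg : IsRegularDeg G r) (hr : 2 ≤ r) (hHreg : IsRegularDeg H s)
    (e : Sym2 V) (he : e ∈ G.edgeSet) (F : Sym2 (V × W) → ℕ)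
    (hF : PropC ((G.deleteEdges {e}) □ H) F) :
    2 ≤ numPalettes ((G.deleteEdges {e}) □ H) F := by
  induction e using Sym2.ind with
  | _ u v =>
  have huv : G.Adj u v := he
  have du : vertDegree (G.deleteEdges {s(u,v)}) u < r := by
    rw [← hGreg u]
    apply Set.ncard_lt_ncard _ (Set.toFinite _)
    refine ⟨fun w hw => ?_, fun hsub => ?_⟩
    · exact (SimpleGraph.deleteEdges_adj.1 hw).1
    · have := hsub (show v ∈ G.neighborSet u from huv)
      exact (SimpleGraph.deleteEdges_adj.1 this).2 rfl
  obtain ⟨w, hw, hwv⟩ : ∃ w, G.Adj u w ∧ w ≠ v := by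
    have h1 : 1 < (G.neighborSet u).ncard := by
      have := hGreg u
      unfold vertDegree at this
      omega
    obtain ⟨w, hw, hne⟩ := Set.exists_ne_of_one_lt_ncard h1 v
    exact ⟨w, hw, hne⟩
  have dw : vertDegree (G.deleteEdges {s(u,v)}) w = r := by
    rw [← hGreg w]
    unfold vertDegree
    congr 1
    ext z
    simp only [SimpleGraph.mem_neighborSet, SimpleGraph.deleteEdges_adj, Set.mem_singleton_iff]
    refine ⟨fun h => h.1, fun h => ⟨h, fun heq => ?_⟩⟩
    have : w ∈ s(u,v) := heq ▸ Sym2.mem_mk_left w z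
    rcases Sym2.mem_iff.1 this with rfl | rfl
    · exact G.loopless.irrefl _ hw
    · exact hwv rfl
  have hne : palette ((G.deleteEdges {s(u,v)}) □ H) F (u,x) ≠
      palette ((G.deleteEdges {s(u,v)}) □ H) F (w,x) := by
    intro h
    have := congrArg Set.ncard h
    rw [pal_ncard _ _ hF, pal_ncard _ _ hF, box_deg, box_deg, dw] at this
    dsimp only at this
    omega
  unfold numPalettes
  have : 1 < (Set.range (palette ((G.deleteEdges {s(u,v)}) □ H) F)).ncard := by
    rw [Set.one_lt_ncard (Set.finite_range _)]
    exact ⟨_, ⟨_, rfl⟩, _, ⟨_, rfl⟩, hne⟩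
  omega

/-- If `G` and `H` are finite connected regular simple graphs, `G` is
class 1 and `r`-regular with `r ≥ 2`, and `e` is an edge of `G`, then
`š((G − e) □ H) = 2`. -/
theorem paletteIndex_boxProd_deleteEdge {V W : Type*} [Fintype V] [Fintype W]
    (G : SimpleGraph V) (H : SimpleGraph W) (r : ℕ)
    (hGconn : G.Connected) (hHconn : H.Connected)
    (hGreg : IsRegularDeg G r) (hr : 2 ≤ r) (hHreg : ∃ r', IsRegularDeg H r')
    (hG1 : IsClass1 G) (e : Sym2 V) (he : e ∈ G.edgeSet) :
    paletteIndex ((G.deleteEdges {e}) □ H) = 2 := by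
  obtain ⟨s, hs⟩ := hHreg
  obtain ⟨x⟩ := hHconn.nonempty
  have := hGconn.nonempty
  obtain ⟨F, hF, hF2⟩ := exists_col G H r s hGreg hr hs hG1 e
  have hge := fun F hF => two_le G H r s x hGreg hr hs e he F hF
  unfold paletteIndex
  apply le_antisymm
  · exact Nat.sInf_le ⟨F, (propC_iff _ _).2 hF, le_antisymm hF2 (hge F hF)⟩
  · refine le_csInf (Set.nonempty_of_mem (x := numPalettes (G.deleteEdges {e} □ H) F)
      ⟨F, (propC_iff _ _).2 hF, rfl⟩) ?_
    rintro n ⟨F', hF', rfl⟩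
    exact hge F' ((propC_iff _ _).1 hF')
end

section
/- For every integer n ≥ 3, the palette index of the path P_n on n vertices equals 2 if n is even, and equals 3 if n is odd. -/
open SimpleGraph

/-- The color of the `i`-th edge of the path. -/
def pathCol (n : ℕ) (f : Sym2 (Fin n) → ℕ) (i : ℕ) : ℕ :=
  if h : i + 1 < n then f s(⟨i, by omega⟩, ⟨i + 1, h⟩) else 0

lemma mem_palette_path (n : ℕ) (f : Sym2 (Fin n) → ℕ) (v : Fin n) (x : ℕ) :
    x ∈ palette (pathGraph n) f v ↔
      (v.val + 1 < n ∧ pathCol n f v.val = x) ∨ (0 < v.val ∧ pathCol n f (v.val - 1) = x) := by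
  constructor
  · rintro ⟨e, he, hv, hx⟩
    induction e using Sym2.ind with
    | _ a b =>
      rw [mem_edgeSet, pathGraph_adj] at he
      obtain ⟨a, ha⟩ := a
      obtain ⟨b, hb⟩ := b
      simp only [Sym2.mem_iff] at hv
      simp only at he
      rcases he with rfl | rfl
      · rcases hv with rfl | rfl
        · left; exact ⟨hb, by simpa [pathCol, hb] using hx⟩
        · right; exact ⟨by simp, by simpa [pathCol, hb] using hx⟩
      · rw [Sym2.eq_swap] at hx
        rcases hv with rfl | rfl
        · right; exact ⟨by simp, by simpa [pathCol, ha] using hx⟩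
        · left; exact ⟨ha, by simpa [pathCol, ha] using hx⟩
  · obtain ⟨v, hv⟩ := v
    rintro (⟨h, rfl⟩ | ⟨h, rfl⟩)
    · refine ⟨s(⟨v, hv⟩, ⟨v + 1, h⟩), ?_, by simp, ?_⟩
      · simp [pathGraph_adj]
      · simp only at h
        simp [pathCol, h]
    · obtain _ | v := v
      · simp at h
      refine ⟨s(⟨v, by omega⟩, ⟨v + 1, hv⟩), ?_, by simp, ?_⟩
      · simp [pathGraph_adj]
      · simp [pathCol, hv]

lemma pathCol_ne (n : ℕ) (f : Sym2 (Fin n) → ℕ) (hf : IsProperEdgeColoring (pathGraph n) f)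
    (i : ℕ) (hi : i + 2 < n) : pathCol n f i ≠ pathCol n f (i + 1) := by
  have h1 : i + 1 < n := by omega
  have h2 : i + 1 + 1 < n := by omega
  simp only [pathCol, h1, h2, dif_pos]
  apply hf
  · simp [pathGraph_adj]
  · simp [pathGraph_adj]
  · simp; omega
  · exact ⟨⟨i + 1, h1⟩, by simp, by simp⟩

/-- The alternating coloring. -/
def altCol (n : ℕ) : Sym2 (Fin n) → ℕ :=
  Sym2.lift ⟨fun a b => (a.val + b.val) / 2 % 2, fun a b => by simp only [Nat.add_comm]⟩

lemma altCol_proper (n : ℕ) : IsProperEdgeColoring (pathGraph n) (altCol n) := by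
  intro e₁ h₁ e₂ h₂ hne ⟨v, hv₁, hv₂⟩
  induction e₁ using Sym2.ind with
  | _ a b =>
  induction e₂ using Sym2.ind with
  | _ c d =>
    rw [mem_edgeSet, pathGraph_adj] at h₁ h₂
    simp only [Sym2.mem_iff, Fin.ext_iff] at hv₁ hv₂
    simp only [ne_eq, Sym2.eq_iff, Fin.ext_iff] at hne
    simp only [altCol, Sym2.lift_mk]
    omega

lemma pathCol_alt (n i : ℕ) (hi : i + 1 < n) : pathCol n (altCol n) i = i % 2 := by
  simp only [pathCol, hi, dif_pos, altCol, Sym2.lift_mk]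
  omega

lemma palette_alt (n : ℕ) (hn : 3 ≤ n) (v : Fin n) :
    palette (pathGraph n) (altCol n) v =
      if v.val = 0 then {0} else if v.val + 1 < n then {0, 1} else {n % 2} := by
  ext x
  rw [mem_palette_path]
  have hv := v.isLt
  split_ifs with h1 h2
  · have : v.val + 1 < n := by omega
    rw [pathCol_alt n _ this]
    simp only [Set.mem_singleton_iff]
    omega
  · rw [pathCol_alt n _ h2, pathCol_alt n _ (by omega)]
    simp only [Set.mem_singleton_iff, Set.mem_insert_iff]
    omega
  · rw [pathCol_alt n (v.val - 1) (by omega)]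
    simp only [Set.mem_singleton_iff]
    omega

lemma path_end_ne_mid (n : ℕ) (f : Sym2 (Fin n) → ℕ)
    (hf : IsProperEdgeColoring (pathGraph n) f) (u v : Fin n)
    (hu : u.val = 0 ∨ u.val + 1 = n) (hv : 0 < v.val) (hv' : v.val + 1 < n) :
    palette (pathGraph n) f u ≠ palette (pathGraph n) f v := by
  intro h
  have hne := pathCol_ne n f hf (v.val - 1) (by omega)
  rw [Nat.sub_add_cancel hv] at hne
  have h1 : pathCol n f v.val ∈ palette (pathGraph n) f u := by
    rw [h, mem_palette_path]; exact Or.inl ⟨hv', rfl⟩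
  have h2 : pathCol n f (v.val - 1) ∈ palette (pathGraph n) f u := by
    rw [h, mem_palette_path]; exact Or.inr ⟨hv, rfl⟩
  rw [mem_palette_path] at h1 h2
  omega

lemma two_le_num (n : ℕ) (hn : 3 ≤ n) (f : Sym2 (Fin n) → ℕ)
    (hf : IsProperEdgeColoring (pathGraph n) f) : 2 ≤ numPalettes (pathGraph n) f := by
  have h := path_end_ne_mid n f hf ⟨0, by omega⟩ ⟨1, by omega⟩ (by simp) (by simp) (by simp; omega)
  rw [← Set.ncard_pair h]
  apply Set.ncard_le_ncard _ (Set.finite_range _)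
  rintro _ (rfl | rfl) <;> exact ⟨_, rfl⟩

lemma three_le_of (n : ℕ) (f : Sym2 (Fin n) → ℕ) (u v w : Fin n)
    (h1 : palette (pathGraph n) f u ≠ palette (pathGraph n) f v)
    (h2 : palette (pathGraph n) f u ≠ palette (pathGraph n) f w)
    (h3 : palette (pathGraph n) f v ≠ palette (pathGraph n) f w) :
    3 ≤ numPalettes (pathGraph n) f := by
  have : ({palette (pathGraph n) f u, palette (pathGraph n) f v,
      palette (pathGraph n) f w} : Set (Set ℕ)).ncard = 3 :=
    Set.ncard_eq_three.2 ⟨_, _, _, h1, h2, h3, rfl⟩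
  rw [← this]
  apply Set.ncard_le_ncard _ (Set.finite_range _)
  rintro _ (rfl | rfl | rfl) <;> exact ⟨_, rfl⟩

lemma three_le_num (n : ℕ) (hn : 3 ≤ n) (ho : Odd n) (f : Sym2 (Fin n) → ℕ)
    (hf : IsProperEdgeColoring (pathGraph n) f) : 3 ≤ numPalettes (pathGraph n) f := by
  by_contra hlt
  have key : ∀ i : ℕ, i + 1 < n →
      pathCol n f i = if i % 2 = 0 then pathCol n f 0 else pathCol n f 1 := by
    intro i
    induction i with
    | zero => simp
    | succ i ih =>
      intro hi
      have ih := ih (by omega)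
      have hne := pathCol_ne n f hf i (by omega)
      have heq : palette (pathGraph n) f ⟨1, by omega⟩
          = palette (pathGraph n) f ⟨i + 1, by omega⟩ := by
        by_contra hne'
        exact hlt (three_le_of n f ⟨0, by omega⟩ ⟨1, by omega⟩ ⟨i + 1, by omega⟩
          (path_end_ne_mid n f hf _ _ (by simp) (by simp) (by simp; omega))
          (path_end_ne_mid n f hf _ _ (by simp) (by simp) (by simpa using hi)) hne')
      have hm : pathCol n f (i + 1) ∈ palette (pathGraph n) f ⟨1, by omega⟩ := by
        rw [heq, mem_palette_path]; exact Or.inl ⟨hi, rfl⟩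
      rw [mem_palette_path] at hm
      simp only [Nat.sub_self] at hm
      split_ifs at ih ⊢ <;> omega
  have heq : palette (pathGraph n) f ⟨0, by omega⟩
      = palette (pathGraph n) f ⟨n - 1, by omega⟩ := by
    by_contra hne'
    exact hlt (three_le_of n f ⟨0, by omega⟩ ⟨n - 1, by omega⟩ ⟨1, by omega⟩ hne'
      (path_end_ne_mid n f hf _ _ (by simp) (by simp) (by simp; omega))
      (path_end_ne_mid n f hf _ _ (by simp; omega) (by simp) (by simp; omega)))
  have hm : pathCol n f 0 ∈ palette (pathGraph n) f ⟨n - 1, by omega⟩ := by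
    rw [← heq, mem_palette_path]; exact Or.inl ⟨by simp; omega, rfl⟩
  rw [mem_palette_path] at hm
  simp only at hm
  have hk := key (n - 1 - 1) (by omega)
  have hne := pathCol_ne n f hf 0 (by omega)
  obtain ⟨k, hk'⟩ := ho
  rw [if_neg (by omega)] at hk
  simp only [Nat.zero_add] at hne
  omega

lemma ncard_pair_le_two (a b : Set ℕ) : ({a, b} : Set (Set ℕ)).ncard ≤ 2 := by
  have := Set.ncard_insert_le a {b}
  rw [Set.ncard_singleton] at this
  exact this

/-- For `n ≥ 3`, `š(P_n) = 2` if `n` is even and `š(P_n) = 3` if `n`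
is odd. -/
theorem paletteIndex_pathGraph (n : ℕ) (hn : 3 ≤ n) :
    (Even n → paletteIndex (pathGraph n) = 2) ∧
    (Odd n → paletteIndex (pathGraph n) = 3) := by
  have hup : paletteIndex (pathGraph n) ≤ numPalettes (pathGraph n) (altCol n) :=
    Nat.sInf_le ⟨altCol n, altCol_proper n, rfl⟩
  have hlow : ∃ f, IsProperEdgeColoring (pathGraph n) f ∧
      numPalettes (pathGraph n) f = paletteIndex (pathGraph n) :=
    Nat.sInf_mem (s := {m | ∃ f, IsProperEdgeColoring (pathGraph n) f ∧
      numPalettes (pathGraph n) f = m}) ⟨_, altCol n, altCol_proper n, rfl⟩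
  obtain ⟨f, hf, hfe⟩ := hlow
  constructor
  · intro he
    apply le_antisymm
    · refine hup.trans ?_
      have hs : Set.range (palette (pathGraph n) (altCol n)) ⊆ {{0}, {0, 1}} := by
        rintro _ ⟨v, rfl⟩
        rw [palette_alt n hn, Nat.even_iff.1 he]
        split_ifs <;> simp
      exact (Set.ncard_le_ncard hs (by simp)).trans (ncard_pair_le_two _ _)
    · rw [← hfe]; exact two_le_num n hn f hf
  · intro ho
    apply le_antisymm
    · refine hup.trans ?_
      have hs : Set.range (palette (pathGraph n) (altCol n)) ⊆ {{1}, {0}, {0, 1}} := by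
        rintro _ ⟨v, rfl⟩
        rw [palette_alt n hn, Nat.odd_iff.1 ho]
        split_ifs <;> simp
      refine (Set.ncard_le_ncard hs (by simp)).trans ((Set.ncard_insert_le _ _).trans ?_)
      have := ncard_pair_le_two ({0} : Set ℕ) {0, 1}
      omega
    · rw [← hfe]; exact three_le_num n hn ho f hf
end

section
/- For every integer n ≥ 3, the palette index of the cycle C_n on n vertices equals 1 if n is even, and equals 3 if n is odd. -/
open SimpleGraph

namespace PalCyc

open Fin.CommRing

lemma mem_edge {m : ℕ} (v : Fin (m+3)) (e : Sym2 (Fin (m+3))) :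
    (e ∈ (cycleGraph (m+3)).edgeSet ∧ v ∈ e) ↔ (e = s(v, v+1) ∨ e = s(v-1, v)) := by
  constructor
  · rintro ⟨he, hv⟩
    obtain ⟨w, rfl⟩ := Sym2.mem_iff_exists.mp hv
    rw [mem_edgeSet, cycleGraph_adj] at he
    rcases he with h | h
    · right
      have : w = v - 1 := by rw [← h]; abel
      rw [this, Sym2.eq_swap]
    · left
      have : w = v + 1 := by rw [← h]; abel
      rw [this]
  · rintro (rfl | rfl)
    · refine ⟨?_, by simp⟩
      rw [mem_edgeSet, cycleGraph_adj]
      right; abel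
    · refine ⟨?_, by simp⟩
      rw [mem_edgeSet, cycleGraph_adj]
      right; abel

lemma palette_eq {m : ℕ} (f : Sym2 (Fin (m+3)) → ℕ) (v : Fin (m+3)) :
    palette (cycleGraph (m+3)) f v = {f s(v, v+1), f s(v-1, v)} := by
  ext c
  simp only [palette, Set.mem_setOf_eq, Set.mem_insert_iff, Set.mem_singleton_iff]
  constructor
  · rintro ⟨e, he, hv, rfl⟩
    rcases (mem_edge v e).1 ⟨he, hv⟩ with rfl | rfl <;> simp
  · rintro (rfl | rfl)
    · obtain ⟨h1, h2⟩ := (mem_edge v s(v, v+1)).2 (Or.inl rfl)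
      exact ⟨_, h1, h2, rfl⟩
    · obtain ⟨h1, h2⟩ := (mem_edge v s(v-1, v)).2 (Or.inr rfl)
      exact ⟨_, h1, h2, rfl⟩

lemma two_edges_ne {m : ℕ} (v : Fin (m+3)) : s(v, v+1) ≠ s(v-1, v) := by
  intro h
  have h2 : (1 : Fin (m+3)) + 1 ≠ 0 := by
    intro h; simp [Fin.ext_iff, Fin.val_add] at h
    rw [Nat.mod_eq_of_lt (by omega)] at h; omega
  rw [Sym2.eq_iff] at h
  rcases h with ⟨h, h'⟩ | ⟨_, h⟩
  · simp at h'
  · apply h2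
    have := congrArg (fun x => x - v + 1) h
    simpa using this

lemma proper_iff {m : ℕ} (f : Sym2 (Fin (m+3)) → ℕ) :
    IsProperEdgeColoring (cycleGraph (m+3)) f ↔ ∀ v, f s(v, v+1) ≠ f s(v-1, v) := by
  constructor
  · intro h v
    obtain ⟨h1, h2⟩ := (mem_edge v s(v, v+1)).2 (Or.inl rfl)
    obtain ⟨h3, h4⟩ := (mem_edge v s(v-1, v)).2 (Or.inr rfl)
    exact h _ h1 _ h3 (two_edges_ne v) ⟨v, h2, h4⟩
  · rintro h e₁ h1 e₂ h2 hne ⟨v, hv1, hv2⟩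
    rcases (mem_edge v e₁).1 ⟨h1, hv1⟩ with rfl | rfl <;>
      rcases (mem_edge v e₂).1 ⟨h2, hv2⟩ with rfl | rfl
    · exact absurd rfl hne
    · exact h v
    · exact (h v).symm
    · exact absurd rfl hne

lemma even_of_common {m : ℕ} (f : Sym2 (Fin (m+3)) → ℕ)
    (hf : ∀ v, f s(v, v+1) ≠ f s(v-1, v)) (c : ℕ)
    (hc : ∀ v, c = f s(v, v+1) ∨ c = f s(v-1, v)) : Even (m+3) := by
  have key : ∀ k : ℕ, (f s((k : Fin (m+3)), (k : Fin (m+3)) + 1) = c) ↔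
      (Even k ↔ f s((0 : Fin (m+3)), 0 + 1) = c) := by
    intro k
    induction k with
    | zero => simp
    | succ k ih =>
      have h1 := hf ((k+1 : ℕ) : Fin (m+3))
      have h2 := hc ((k+1 : ℕ) : Fin (m+3))
      have h3 : ((k+1 : ℕ) : Fin (m+3)) - 1 = (k : Fin (m+3)) := by push_cast; abel
      have h4 : ((k+1 : ℕ) : Fin (m+3)) = (k : Fin (m+3)) + 1 := by push_cast; rfl
      rw [h3] at h1 h2
      rw [h4] at h1 h2 ⊢
      rw [Nat.even_add_one]
      grind
  have := key (m+3)
  rw [Fin.natCast_self] at this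
  tauto

lemma three_le {m : ℕ} (f : Sym2 (Fin (m+3)) → ℕ)
    (hf : ∀ v, f s(v, v+1) ≠ f s(v-1, v)) (ho : Odd (m+3)) :
    3 ≤ numPalettes (cycleGraph (m+3)) f := by
  by_contra hlt
  set P := palette (cycleGraph (m+3)) f with hP
  have hn : ¬ ∃ c, ∀ v, c ∈ P v := by
    rintro ⟨c, hc⟩
    refine Nat.not_even_iff_odd.2 ho (even_of_common f hf c fun v => ?_)
    have := hc v
    rw [hP, palette_eq] at this
    simpa using this
  by_cases hall : ∀ v, P (v+1) = P v
  · have : ∀ k : ℕ, P (k : Fin (m+3)) = P 0 := by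
      intro k
      induction k with
      | zero => simp
      | succ k ih => rw [← ih, ← hall (k : Fin (m+3))]; push_cast; rfl
    refine hn ⟨f s(0, 0+1), fun v => ?_⟩
    have h := this v.val
    rw [Fin.cast_val_eq_self] at h
    rw [h, hP, palette_eq]; simp
  · push Not at hall
    obtain ⟨v, hv⟩ := hall
    refine hn ⟨f s(v, v+1), fun w => ?_⟩
    have h1 : f s(v, v+1) ∈ P v := by rw [hP, palette_eq]; simp
    have h2 : f s(v, v+1) ∈ P (v+1) := by rw [hP, palette_eq]; simp
    by_contra hw
    apply hlt
    have h3 : ({P v, P (v+1), P w} : Set (Set ℕ)).ncard = 3 := by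
      rw [Set.ncard_eq_three]
      refine ⟨_, _, _, hv.symm, ?_, ?_, rfl⟩
      · intro h; rw [h] at h1; exact hw h1
      · intro h; rw [h] at h2; exact hw h2
    refine h3.symm.le.trans ?_
    apply Set.ncard_le_ncard _ (Set.finite_range _)
    rintro x (rfl | rfl | rfl) <;> exact ⟨_, rfl⟩

/-- The explicit coloring: consecutive edges alternate, the closing edge has color `c`. -/
def col (n c : ℕ) : Sym2 (Fin n) → ℕ :=
  Sym2.lift ⟨fun i j => if i.val + 1 = j.val then i.val % 2 else
    if j.val + 1 = i.val then j.val % 2 else c, by intro i j; grind⟩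

lemma col_succ {m : ℕ} (c : ℕ) (v : Fin (m+3)) :
    col (m+3) c s(v, v+1) = if v.val = m + 2 then c else v.val % 2 := by
  have hv := v.isLt
  simp only [col, Sym2.lift_mk]
  by_cases h : v.val = m + 2
  · have : (v+1).val = 0 := by simp [Fin.val_add, h]
    rw [this]; simp [h]
  · have : (v+1).val = v.val + 1 := by
      rw [Fin.val_add]; simp; omega
    rw [this]; simp [h]

lemma col_pred {m : ℕ} (c : ℕ) (v : Fin (m+3)) :
    col (m+3) c s(v-1, v) = if v.val = 0 then c else (v.val - 1) % 2 := by
  have hv := v.isLt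
  have h := col_succ c (v-1)
  rw [sub_add_cancel] at h
  rw [h]
  by_cases h0 : v.val = 0
  · have : v = 0 := Fin.ext h0
    subst this
    have : ((0 : Fin (m+3)) - 1).val = m + 2 := by simp [Fin.val_sub]
    simp [this]
  · have : (v-1).val = v.val - 1 := by
      rw [Fin.val_sub_one_of_ne_zero]
      intro h; apply h0; simp [h]
    rw [this, if_neg h0, if_neg (by omega)]

lemma even_case {m : ℕ} (he : Even (m+3)) : paletteIndex (cycleGraph (m+3)) = 1 := by
  have h2 : (m+3) % 2 = 0 := Nat.even_iff.1 he
  apply le_antisymm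
  · apply Nat.sInf_le
    refine ⟨col (m+3) 1, ?_, ?_⟩
    · rw [proper_iff]
      intro v
      rw [col_succ, col_pred]
      have := v.isLt
      split_ifs <;> omega
    · rw [numPalettes, Set.ncard_eq_one]
      refine ⟨{0, 1}, ?_⟩
      have : ∀ v, palette (cycleGraph (m+3)) (col (m+3) 1) v = {0, 1} := by
        intro v
        rw [palette_eq, col_succ, col_pred]
        have := v.isLt
        ext x
        simp only [Set.mem_insert_iff, Set.mem_singleton_iff]
        split_ifs <;> omega
      rw [show palette (cycleGraph (m+3)) (col (m+3) 1) = fun _ => {0, 1} from funext this]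
      exact Set.range_const
  · apply le_csInf
    · exact ⟨_, col (m+3) 2, (proper_iff _).2 (by
        intro v
        rw [col_succ, col_pred]
        have := v.isLt
        split_ifs <;> omega), rfl⟩
    · rintro k ⟨f, -, rfl⟩
      exact (Set.ncard_pos (Set.finite_range _)).2 (Set.range_nonempty _)

lemma odd_case {m : ℕ} (ho : Odd (m+3)) : paletteIndex (cycleGraph (m+3)) = 3 := by
  have hp : IsProperEdgeColoring (cycleGraph (m+3)) (col (m+3) 2) := by
    rw [proper_iff]
    intro v
    rw [col_succ, col_pred]
    have := v.isLt
    split_ifs <;> omega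
  have h2 : (m+3) % 2 = 1 := Nat.odd_iff.1 ho
  apply le_antisymm
  · have hle : numPalettes (cycleGraph (m+3)) (col (m+3) 2) ≤ 3 := by
      have hsub : Set.range (palette (cycleGraph (m+3)) (col (m+3) 2)) ⊆
          (({{0, 1}, {0, 2}, {1, 2}} : Finset (Set ℕ)) : Set (Set ℕ)) := by
        rintro _ ⟨v, rfl⟩
        rw [palette_eq, col_succ, col_pred]
        have := v.isLt
        simp only [Finset.coe_insert, Finset.coe_singleton, Set.mem_insert_iff,
          Set.mem_singleton_iff]
        by_cases h0 : v.val = 0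
        · right; left
          ext x
          simp only [Set.mem_insert_iff, Set.mem_singleton_iff]
          split_ifs <;> omega
        · by_cases h1 : v.val = m + 2
          · right; right
            ext x
            simp only [Set.mem_insert_iff, Set.mem_singleton_iff]
            split_ifs; omega
          · left
            ext x
            simp only [Set.mem_insert_iff, Set.mem_singleton_iff]
            split_ifs; omega
      refine (Set.ncard_le_ncard hsub (Finset.finite_toSet _)).trans ?_
      rw [Set.ncard_coe_finset]
      exact Finset.card_le_three
    refine le_trans ?_ hle
    exact Nat.sInf_le ⟨_, hp, rfl⟩
  · refine le_csInf ⟨_, _, hp, rfl⟩ ?_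
    rintro k ⟨f, hf, rfl⟩
    exact three_le f ((proper_iff f).1 hf) ho

end PalCyc

/-- For `n ≥ 3`, `š(C_n) = 1` if `n` is even and `š(C_n) = 3` if `n`
is odd. -/
theorem paletteIndex_cycleGraph (n : ℕ) (hn : 3 ≤ n) :
    (Even n → paletteIndex (cycleGraph n) = 1) ∧
    (Odd n → paletteIndex (cycleGraph n) = 3) := by
  obtain ⟨m, rfl⟩ := Nat.exists_eq_add_of_le' hn
  exact ⟨PalCyc.even_case, PalCyc.odd_case⟩
end
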